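/- arXiv:1006.3285 — 2 statements merged into one kernel-verified Lean document; each statement's English description precedes it below -/
import Mathlib

section
/- Let m ≥ 1. In the ring ℤ[s,s⁻¹] of Laurent polynomials, with z = s − s⁻¹, the following identity holds: Σ_{λ ⊢ m} ( ℓ(λ)! / (m₁(λ)!·m₂(λ)!·⋯·m_r(λ)!) ) · (∏_{i} λ_i) · z^{2(ℓ(λ)−1)} = Σ_{a=0}^{m−1} s^{2(2a−(m−1))}, where the sum on the left is over all partitions λ of m. (This identifies the combinatorial formula for the 2-graded ruling polynomial R²_{A_m A_{−m}}(z) of Lemma 4.1 with the inner product (A_m, A_m) = (s^{2m} − s^{−2m})/(s² − s^{−2}) of Lemma 5.2.) -/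
open LaurentPolynomial Finset

def cM (M : Multiset ℕ) : ℕ := Nat.multinomial M.toFinset (fun k => M.count k)

lemma cM_spec (M : Multiset ℕ) (s : Finset ℕ) (h : M.toFinset ⊆ s) :
    (∏ i ∈ s, (M.count i).factorial) * cM M = (Multiset.card M).factorial := by
  have h1 := Nat.multinomial_spec M.toFinset (fun k => M.count k)
  rw [Multiset.toFinset_sum_count_eq] at h1
  rw [← h1, cM]
  congr 1
  symm
  apply Finset.prod_subset h
  intro x _ hx
  rw [Multiset.mem_toFinset] at hx
  simp [Multiset.count_eq_zero_of_notMem hx]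

lemma cM_rec (M : Multiset ℕ) (h : M ≠ 0) :
    cM M = ∑ k ∈ M.toFinset, cM (M.erase k) := by
  have hpos : 0 < ∏ i ∈ M.toFinset, (M.count i).factorial :=
    Finset.prod_pos fun i _ => Nat.factorial_pos _
  apply Nat.eq_of_mul_eq_mul_left hpos
  rw [cM_spec M _ (Finset.Subset.refl _), Finset.mul_sum]
  have key : ∀ k ∈ M.toFinset, (∏ i ∈ M.toFinset, (M.count i).factorial) * cM (M.erase k)
      = M.count k * (Multiset.card M - 1).factorial := by
    intro k hk
    have hk' : k ∈ M := Multiset.mem_toFinset.1 hk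
    have hc : Multiset.card (M.erase k) = Multiset.card M - 1 := Multiset.card_erase_of_mem hk'
    rw [← hc, ← cM_spec (M.erase k) M.toFinset
      (Multiset.toFinset_subset.2 (Multiset.subset_of_le (Multiset.erase_le _ _))), ← mul_assoc]
    congr 1
    rw [← Finset.mul_prod_erase _ _ hk, ← Finset.mul_prod_erase _ _ hk, ← mul_assoc,
      Multiset.count_erase_self, Nat.mul_factorial_pred (Multiset.count_ne_zero.2 hk')]
    congr 1
    apply Finset.prod_congr rfl
    intro i hi
    rw [Multiset.count_erase_of_ne (Finset.ne_of_mem_erase hi)]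
  rw [Finset.sum_congr rfl key, ← Finset.sum_mul, Multiset.toFinset_sum_count_eq,
    Nat.mul_factorial_pred (by simpa using h)]

lemma part_rec {R : Type*} [CommRing R] (w : R) (m : ℕ) (hm : 1 ≤ m) :
    ∑ p : Nat.Partition m, (cM p.parts : R) * (p.parts.prod : ℕ) * w ^ (Multiset.card p.parts - 1)
    = ∑ k ∈ Finset.Icc 1 m, (k : R) * ∑ q : Nat.Partition (m - k),
        (cM q.parts : R) * (q.parts.prod : ℕ) * w ^ (Multiset.card q.parts) := by
  have h1 : ∀ p : Nat.Partition m,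
      (cM p.parts : R) * (p.parts.prod : ℕ) * w ^ (Multiset.card p.parts - 1)
      = ∑ k ∈ Finset.Icc 1 m, if k ∈ p.parts then
        (k : R) * ((cM (p.parts.erase k) : R) * ((p.parts.erase k).prod : ℕ)
          * w ^ (Multiset.card (p.parts.erase k))) else 0 := by
    intro p
    have hne : p.parts ≠ 0 := by
      intro h
      have := p.parts_sum
      rw [h] at this
      simp at this
      omega
    rw [cM_rec _ hne, ← Finset.sum_filter]
    have hf : (Finset.Icc 1 m).filter (fun k => k ∈ p.parts) = p.parts.toFinset := by
      ext k
      simp only [Finset.mem_filter, Finset.mem_Icc, Multiset.mem_toFinset]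
      exact ⟨fun h => h.2, fun h => ⟨⟨p.parts_pos h, Nat.Partition.le_of_mem_parts h⟩, h⟩⟩
    rw [hf, Nat.cast_sum, Finset.sum_mul, Finset.sum_mul]
    apply Finset.sum_congr rfl
    intro k hk
    have hk' : k ∈ p.parts := Multiset.mem_toFinset.1 hk
    have hc : Multiset.card (p.parts.erase k) = Multiset.card p.parts - 1 :=
      Multiset.card_erase_of_mem hk'
    rw [hc, ← Multiset.prod_erase hk']
    push_cast
    ring
  rw [Finset.sum_congr rfl fun p _ => h1 p, Finset.sum_comm]
  apply Finset.sum_congr rfl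
  intro k hk
  rw [Finset.mem_Icc] at hk
  rw [← Finset.sum_filter, Finset.mul_sum]
  rw [← Finset.sum_subtype_eq_sum_filter, Finset.subtype_univ]
  apply Fintype.sum_equiv (Nat.Partition.partitionWithPartEquiv hk.1 hk.2)
  intro p
  simp

noncomputable def Sm (m : ℕ) : LaurentPolynomial ℤ :=
  ∑ a ∈ Finset.range m, T (2 * (2 * (a : ℤ) - ((m : ℤ) - 1)))

lemma Sm_succ (m : ℕ) : Sm (m+1) = T (-2) * Sm m + T (2 * m) := by
  unfold Sm
  rw [Finset.sum_range_succ, Finset.mul_sum]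
  congr 1
  · apply Finset.sum_congr rfl
    intro a _
    rw [← T_add]; congr 1; push_cast; ring
  · congr 1; push_cast; ring

lemma Sm_succ' (m : ℕ) : Sm (m+1) = T 2 * Sm m + T (-(2 * m)) := by
  unfold Sm
  rw [Finset.sum_range_succ', Finset.mul_sum]
  congr 1
  · apply Finset.sum_congr rfl
    intro a _
    rw [← T_add]; congr 1; push_cast; ring
  · congr 1; push_cast; ring

lemma w_eq : ((T 1 - T (-1)) ^ 2 : LaurentPolynomial ℤ) = T 2 + T (-2) - 2 := by
  have h : (T 1 * T (-1) : LaurentPolynomial ℤ) = 1 := by rw [← T_add]; simp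
  have h1 : (T 1 * T 1 : LaurentPolynomial ℤ) = T 2 := by rw [← T_add]; norm_num
  have h2 : (T (-1) * T (-1) : LaurentPolynomial ℤ) = T (-2) := by rw [← T_add]; norm_num
  linear_combination h1 + h2 - 2 * h

lemma Sm_rec (m : ℕ) : Sm (m+2) - 2 * Sm (m+1) + Sm m = (T 1 - T (-1)) ^ 2 * Sm (m+1) := by
  rw [w_eq]
  have h : (T 2 * T (-2) : LaurentPolynomial ℤ) = 1 := by rw [← T_add]; simp
  have h3 : (T 2 * T (2 * m) : LaurentPolynomial ℤ) = T (2 * (m + 1 : ℕ)) := by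
    rw [← T_add]; congr 1; push_cast; ring
  linear_combination Sm_succ (m+1) - T 2 * Sm_succ m - h3 + (- Sm m) * h

lemma Sm_conv (m : ℕ) : Sm m = (m : LaurentPolynomial ℤ) + (T 1 - T (-1)) ^ 2 * ∑ j ∈ Finset.range m, ((m : LaurentPolynomial ℤ) - j) * Sm j ∧
    Sm (m+1) - Sm m = 1 + (T 1 - T (-1)) ^ 2 * ∑ j ∈ Finset.range (m+1), Sm j := by
  induction m with
  | zero => simp [Sm]
  | succ m ih =>
    obtain ⟨h1, h2⟩ := ih
    constructor
    · have : ∑ j ∈ Finset.range (m+1), (((m+1 : ℕ) : LaurentPolynomial ℤ) - j) * Sm j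
        = ∑ j ∈ Finset.range m, ((m : LaurentPolynomial ℤ) - j) * Sm j
          + ∑ j ∈ Finset.range (m+1), Sm j := by
        have e : ∑ j ∈ Finset.range m, ((m : LaurentPolynomial ℤ) - j) * Sm j
          = ∑ j ∈ Finset.range (m+1), ((m : LaurentPolynomial ℤ) - j) * Sm j := by
          rw [Finset.sum_range_succ]; simp
        rw [e, ← Finset.sum_add_distrib]
        apply Finset.sum_congr rfl
        intro j _
        push_cast; ring
      rw [this]
      push_cast
      linear_combination h1 + h2
    · rw [Finset.sum_range_succ]
      linear_combination h2 + Sm_rec m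

noncomputable def Hm (m : ℕ) : LaurentPolynomial ℤ :=
  ∑ q : Nat.Partition m, (cM q.parts : LaurentPolynomial ℤ) * ((q.parts.prod : ℕ) : LaurentPolynomial ℤ) *
      ((T 1 - T (-1)) ^ 2) ^ (Multiset.card q.parts)

noncomputable def Gm (m : ℕ) : LaurentPolynomial ℤ :=
  ∑ q : Nat.Partition m, (cM q.parts : LaurentPolynomial ℤ) * ((q.parts.prod : ℕ) : LaurentPolynomial ℤ) *
      ((T 1 - T (-1)) ^ 2) ^ (Multiset.card q.parts - 1)

lemma Hm_zero : Hm 0 = 1 := by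
  simp [Hm, cM]

lemma Hm_eq (m : ℕ) (hm : 1 ≤ m) : Hm m = (T 1 - T (-1)) ^ 2 * Gm m := by
  unfold Hm Gm
  rw [Finset.mul_sum]
  apply Finset.sum_congr rfl
  intro p _
  have hne : Multiset.card p.parts ≠ 0 := by
    intro h
    have := p.parts_sum
    rw [Multiset.card_eq_zero.1 h] at this
    simp at this
    omega
  obtain ⟨c, hc⟩ := Nat.exists_eq_succ_of_ne_zero hne
  rw [hc, Nat.succ_sub_one, pow_succ]
  ring

lemma main_aux (m : ℕ) (hm : 1 ≤ m) : Gm m = Sm m := by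
  induction m using Nat.strong_induction_on with
  | _ m ih =>
  have h0 : Gm m = ∑ k ∈ Finset.Icc 1 m, (k : LaurentPolynomial ℤ) * Hm (m - k) :=
    part_rec _ m hm
  rw [h0, (Sm_conv m).1]
  obtain ⟨n, rfl⟩ : ∃ n, m = n + 1 := ⟨m - 1, by omega⟩
  have e : ∀ f : ℕ → LaurentPolynomial ℤ, ∑ k ∈ Finset.Icc 1 (n+1), f k =
      ∑ j ∈ Finset.range (n+1), f (n + 1 - j) := by
    intro f
    apply Finset.sum_bij' (fun k _ => n + 1 - k) (fun k _ => n + 1 - k) <;>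
      simp only [Finset.mem_Icc, Finset.mem_range] <;> intro a ha
    · omega
    · omega
    · omega
    · omega
    · congr 1; omega
  have s0 : Sm 0 = 0 := by simp [Sm]
  rw [e, Finset.sum_range_succ', Finset.sum_range_succ', s0, mul_zero, add_zero, add_comm,
    Finset.mul_sum]
  refine congrArg₂ (· + ·) ?_ ?_
  · rw [Nat.sub_zero, Nat.sub_self, Hm_zero, mul_one]
  · apply Finset.sum_congr rfl
    intro j hj
    rw [Finset.mem_range] at hj
    have h1 : n + 1 - (n + 1 - (j + 1)) = j + 1 := by omega
    rw [h1, Hm_eq _ (by omega), ih (j+1) (by omega) (by omega), Nat.cast_sub (by omega)]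
    ring

/-- For `m ≥ 1`, in `ℤ[s,s⁻¹]` with `z = s - s⁻¹`,
`Σ_{λ ⊢ m} (ℓ(λ)!/∏ m_k(λ)!) · (∏ λ_i) · z^{2(ℓ(λ)-1)} = Σ_{a=0}^{m-1} s^{2(2a-(m-1))}`. -/
theorem ruling_polynomial_eq_inner_product (m : ℕ) (hm : 1 ≤ m) :
    ∑ p : Nat.Partition m,
      ((Nat.multinomial p.parts.toFinset (fun k => p.parts.count k) : ℕ) :
          LaurentPolynomial ℤ) *
        ((p.parts.prod : ℕ) : LaurentPolynomial ℤ) *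
        (T 1 - T (-1)) ^ (2 * (Multiset.card p.parts - 1)) =
    ∑ a ∈ Finset.range m, T (2 * (2 * (a : ℤ) - ((m : ℤ) - 1))) := by
  simp only [pow_mul]
  exact main_aux m hm
end

section
/- For k ≥ 1 define the Laurent polynomial {k} := Σ_{a=0}^{k−1} s^{2(2a−(k−1))} ∈ ℤ[s,s⁻¹] (equal to (s^{2k} − s^{−2k})/(s² − s^{−2})). Then for every m ≥ 1 the recursion {m} = m + (s − s⁻¹)² · Σ_{k=1}^{m−1} (m−k) · {k} holds in ℤ[s,s⁻¹]. (This expresses that the generating function G(t) = 1 + Σ_{m≥1} z² {m} t^m, with z = s − s⁻¹, satisfies G(t)·(1 − Σ_{m≥1} m z² t^m) = 1, which is the key computation in the proof of Lemma 5.2.) -/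
open LaurentPolynomial Finset

/-- `{k} := Σ_{a=0}^{k-1} s^{2(2a-(k-1))} ∈ ℤ[s,s⁻¹]`. -/
noncomputable def bracket (k : ℕ) : LaurentPolynomial ℤ :=
  ∑ a ∈ Finset.range k, T (2 * (2 * (a : ℤ) - ((k : ℤ) - 1)))

lemma bracket_succ (k : ℕ) : bracket (k + 1) = T 2 * bracket k + T (-2 * (k : ℤ)) := by
  unfold bracket
  rw [Finset.sum_range_succ', Finset.mul_sum]
  congr 1
  · refine Finset.sum_congr rfl fun a _ => ?_
    rw [← T_add]
    congr 1
    push_cast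
    ring
  · congr 1
    push_cast
    ring

lemma bracket_rec (k : ℕ) :
    bracket (k + 2) = bracket (k + 1) + (bracket (k + 1) - bracket k)
      + (T 1 - T (-1)) ^ 2 * bracket (k + 1) := by
  have h1 := bracket_succ (k + 1)
  have h2 := bracket_succ k
  have e1 : (T 1 : LaurentPolynomial ℤ) * T (-1) = 1 := by rw [← T_add]; simp
  have e2 : (T 2 : LaurentPolynomial ℤ) = T 1 * T 1 := by rw [← T_add]; norm_num
  have e3 : (T (-2 * ((k + 1 : ℕ) : ℤ)) : LaurentPolynomial ℤ)
      = T (-1) * T (-1) * T (-2 * (k : ℤ)) := by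
    rw [← T_add, ← T_add]; congr 1; push_cast; ring
  rw [e3, e2] at h1
  rw [e2] at h2
  generalize (T 1 : LaurentPolynomial ℤ) = x at *
  generalize (T (-1) : LaurentPolynomial ℤ) = y at *
  linear_combination h1 - y * y * h2 + (2 * bracket (k + 1) - (x * y + 1) * bracket k) * e1

lemma bracket_diff (m : ℕ) : bracket (m + 1) - bracket m
    = 1 + (T 1 - T (-1)) ^ 2 * ∑ k ∈ Finset.Ico 1 (m + 1), bracket k := by
  induction m with
  | zero => simp [bracket]
  | succ n ih =>
    rw [Finset.sum_Ico_succ_top (by omega)]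
    linear_combination ih + bracket_rec n

lemma bracket_aux (m : ℕ) :
    ∑ k ∈ Finset.Ico 1 (m + 1), ((m + 1 - k : ℕ) : LaurentPolynomial ℤ) * bracket k
    = ∑ k ∈ Finset.Ico 1 m, ((m - k : ℕ) : LaurentPolynomial ℤ) * bracket k
      + ∑ k ∈ Finset.Ico 1 (m + 1), bracket k := by
  rcases Nat.eq_zero_or_pos m with rfl | hm
  · simp
  rw [Finset.sum_Ico_succ_top (by omega), Finset.sum_Ico_succ_top (by omega), ← add_assoc,
    ← Finset.sum_add_distrib]
  congr 1
  · refine Finset.sum_congr rfl fun k hk => ?_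
    rw [Finset.mem_Ico] at hk
    rw [Nat.succ_sub hk.2.le]
    push_cast
    ring
  · simp

/-- For every `m ≥ 1`, `{m} = m + (s - s⁻¹)² · Σ_{k=1}^{m-1} (m-k)·{k}` in `ℤ[s,s⁻¹]`. -/
theorem bracket_recursion (m : ℕ) (hm : 1 ≤ m) :
    bracket m =
      (m : LaurentPolynomial ℤ) +
        (T 1 - T (-1)) ^ 2 *
          ∑ k ∈ Finset.Ico 1 m, ((m - k : ℕ) : LaurentPolynomial ℤ) * bracket k := by
  clear hm
  induction m with
  | zero => simp [bracket]
  | succ n ih =>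
    rw [bracket_aux]
    push_cast
    linear_combination ih + bracket_diff n
end
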